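/- Let γ ∈ (0,∞), ξ ∈ ℝ, and set α(ξ) = (γ + i(⟨ξ⟩ + ξ))/(1 + iγ(⟨ξ⟩ + ξ)). Let K^ℝ_{0,ξ}(z) = (1/(2⟨ξ⟩)) e^{−⟨ξ⟩|z|} [[i, ξ + ⟨ξ⟩·sign(z)], [ξ − ⟨ξ⟩·sign(z), i]] and define, for t, t' ≥ 0, K_{0,ξ}(t,t') = K^ℝ_{0,ξ}(t − t') + α(ξ)·K^ℝ_{0,ξ}(t + t')·σ₁. Then for every smooth compactly supported Ψ = (Ψ₁, Ψ₂) : (0,∞) → ℂ², the function Φ(t) = ∫₀^∞ K_{0,ξ}(t,t') Ψ(t') dt' is smooth on [0,∞), satisfies for all t > 0: ξΦ₂(t) − Φ₂'(t) − iΦ₁(t) = Ψ₁(t) and ξΦ₁(t) + Φ₁'(t) − iΦ₂(t) = Ψ₂(t), and satisfies the boundary condition Φ₂(0) = γ·Φ₁(0). -/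

import Mathlib

noncomputable section

open Complex MeasureTheory

/-- The Japanese bracket `⟨ξ⟩ = √(ξ² + 1)`. -/
def jap (ξ : ℝ) : ℝ := Real.sqrt (ξ ^ 2 + 1)

/-- The boundary coefficient `α(ξ) = (γ + i(⟨ξ⟩ + ξ)) / (1 + iγ(⟨ξ⟩ + ξ))`. -/
def alphaFun (γ ξ : ℝ) : ℂ :=
  ((γ : ℂ) + Complex.I * ((jap ξ + ξ : ℝ) : ℂ)) /
    (1 + Complex.I * (γ : ℂ) * ((jap ξ + ξ : ℝ) : ℂ))

/-- The whole-line resolvent kernel `K^ℝ_{0,ξ}(z)` of the free Dirac fiber operator. -/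
def KR (ξ z : ℝ) : Matrix (Fin 2) (Fin 2) ℂ :=
  (((2 * jap ξ)⁻¹ * Real.exp (-(jap ξ * |z|)) : ℝ) : ℂ) •
    !![Complex.I, ((ξ + jap ξ * Real.sign z : ℝ) : ℂ);
       ((ξ - jap ξ * Real.sign z : ℝ) : ℂ), Complex.I]

/-- The first Pauli matrix `σ₁`. -/
def pauli1 : Matrix (Fin 2) (Fin 2) ℂ := !![0, 1; 1, 0]

/-- The half-line resolvent kernel `K_{0,ξ}(t,t') = K^ℝ_{0,ξ}(t−t') + α(ξ) K^ℝ_{0,ξ}(t+t') σ₁`. -/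
def Khalf (γ ξ t t' : ℝ) : Matrix (Fin 2) (Fin 2) ℂ :=
  KR ξ (t - t') + alphaFun γ ξ • (KR ξ (t + t') * pauli1)

/-- The primitive `t ↦ ∫₀ᵗ e^{a s} Ψ(s) ds`. -/
def expPrimitive (a : ℝ) (Ψ : ℝ → Fin 2 → ℂ) (t : ℝ) : Fin 2 → ℂ :=
  ∫ s in (0 : ℝ)..t, Real.exp (a * s) • Ψ s

/-- The matrix part of `KR ξ z` at points `z` of sign `σ`. -/
def signMatrix (ξ σ : ℝ) : Matrix (Fin 2) (Fin 2) ℂ :=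
  (((2 * jap ξ)⁻¹ : ℝ) : ℂ) •
    !![Complex.I, ((ξ + jap ξ * σ : ℝ) : ℂ); ((ξ - jap ξ * σ : ℝ) : ℂ), Complex.I]

theorem jap_pos (ξ : ℝ) : 0 < jap ξ := Real.sqrt_pos.mpr (by positivity)

theorem jap_sq (ξ : ℝ) : jap ξ ^ 2 = ξ ^ 2 + 1 := Real.sq_sqrt (by positivity)

theorem hasDerivAt_expPrimitive (a : ℝ) {Ψ : ℝ → Fin 2 → ℂ} (hΨ : Continuous Ψ) (t : ℝ) :
    HasDerivAt (expPrimitive a Ψ) (Real.exp (a * t) • Ψ t) t := by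
  have hc : Continuous fun s => Real.exp (a * s) • Ψ s := by fun_prop
  exact intervalIntegral.integral_hasDerivAt_right (hc.intervalIntegrable _ _)
    (hc.stronglyMeasurableAtFilter _ _) hc.continuousAt

theorem contDiff_expPrimitive (a : ℝ) {Ψ : ℝ → Fin 2 → ℂ} (hΨ : ContDiff ℝ (⊤ : ℕ∞) Ψ) :
    ContDiff ℝ (⊤ : ℕ∞) (expPrimitive a Ψ) := by
  have hd := hasDerivAt_expPrimitive a hΨ.continuous
  rw [contDiff_infty_iff_deriv]
  refine ⟨fun t => (hd t).differentiableAt, ?_⟩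
  rw [show deriv (expPrimitive a Ψ) = fun t => Real.exp (a * t) • Ψ t from
    funext fun t => (hd t).deriv]
  fun_prop

theorem KR_of_pos (ξ : ℝ) {z : ℝ} (hz : 0 < z) :
    KR ξ z = Real.exp (-(jap ξ * z)) • signMatrix ξ 1 := by
  ext i j
  fin_cases i <;> fin_cases j <;> simp [KR, signMatrix, abs_of_pos hz, Real.sign_of_pos hz] <;> ring

theorem KR_of_neg (ξ : ℝ) {z : ℝ} (hz : z < 0) :
    KR ξ z = Real.exp (jap ξ * z) • signMatrix ξ (-1) := by
  ext i j
  fin_cases i <;> fin_cases j <;> simp [KR, signMatrix, abs_of_neg hz, Real.sign_of_neg hz] <;> ring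

theorem mulVec_integral {X : Type*} [MeasurableSpace X] {μ : Measure X}
    (M : Matrix (Fin 2) (Fin 2) ℂ) {f : X → Fin 2 → ℂ} (hf : Integrable f μ) :
    Integrable (fun x => M.mulVec (f x)) μ ∧
      ∫ x, M.mulVec (f x) ∂μ = M.mulVec (∫ x, f x ∂μ) := by
  let L : (Fin 2 → ℂ) →L[ℂ] (Fin 2 → ℂ) := LinearMap.toContinuousLinearMap M.mulVecLin
  exact ⟨L.integrable_comp hf, L.integral_comp_comm hf⟩

theorem integrable_exp_smul (a : ℝ) {Ψ : ℝ → Fin 2 → ℂ} (hΨ : Continuous Ψ)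
    (hcs : HasCompactSupport Ψ) : Integrable fun s => Real.exp (a * s) • Ψ s :=
  Continuous.integrable_of_hasCompactSupport (by fun_prop)
    (hcs.smul_left (f := fun s => Real.exp (a * s)))

/-- Variation-of-constants form of the half-line resolvent. -/
theorem integral_Khalf_mulVec (γ ξ : ℝ) {Ψ : ℝ → Fin 2 → ℂ} (hΨ : Continuous Ψ)
    (hcs : HasCompactSupport Ψ) {t : ℝ} (ht : 0 ≤ t) :
    ∫ s in Set.Ioi (0 : ℝ), (Khalf γ ξ t s).mulVec (Ψ s) =
      Real.exp (-(jap ξ * t)) • (signMatrix ξ 1).mulVec (expPrimitive (jap ξ) Ψ t) +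
      Real.exp (jap ξ * t) • (signMatrix ξ (-1)).mulVec
        ((∫ s in Set.Ioi (0 : ℝ), Real.exp (-jap ξ * s) • Ψ s) - expPrimitive (-jap ξ) Ψ t) +
      Real.exp (-(jap ξ * t)) • (alphaFun γ ξ • (signMatrix ξ 1 * pauli1)).mulVec
        (∫ s in Set.Ioi (0 : ℝ), Real.exp (-jap ξ * s) • Ψ s) := by
  have hp := integrable_exp_smul (jap ξ) hΨ hcs
  have hm := integrable_exp_smul (-jap ξ) hΨ hcs
  obtain ⟨i₁, e₁⟩ := mulVec_integral (signMatrix ξ 1) (hp.integrableOn (s := Set.Ioo 0 t))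
  obtain ⟨i₂, e₂⟩ := mulVec_integral (signMatrix ξ (-1)) (hm.integrableOn (s := Set.Ioi t))
  obtain ⟨i₃, e₃⟩ := mulVec_integral (alphaFun γ ξ • (signMatrix ξ 1 * pauli1))
    (hm.integrableOn (s := Set.Ioi 0))
  have c₁ : Set.EqOn (fun s => Real.exp (-(jap ξ * t)) •
      (signMatrix ξ 1).mulVec (Real.exp (jap ξ * s) • Ψ s))
      (fun s => (KR ξ (t - s)).mulVec (Ψ s)) (Set.Ioo 0 t) := by
    intro s hs
    simp only [KR_of_pos ξ (sub_pos.mpr hs.2), Matrix.mulVec_smul, Matrix.smul_mulVec, smul_smul,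
      ← Real.exp_add]
    ring_nf
  have c₂ : Set.EqOn (fun s => Real.exp (jap ξ * t) •
      (signMatrix ξ (-1)).mulVec (Real.exp (-jap ξ * s) • Ψ s))
      (fun s => (KR ξ (t - s)).mulVec (Ψ s)) (Set.Ioi t) := by
    intro s hs
    simp only [KR_of_neg ξ (sub_neg.mpr hs), Matrix.mulVec_smul, Matrix.smul_mulVec, smul_smul,
      ← Real.exp_add]
    ring_nf
  have c₃ : Set.EqOn (fun s => Real.exp (-(jap ξ * t)) •
      (alphaFun γ ξ • (signMatrix ξ 1 * pauli1)).mulVec (Real.exp (-jap ξ * s) • Ψ s))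
      (fun s => (alphaFun γ ξ • (KR ξ (t + s) * pauli1)).mulVec (Ψ s)) (Set.Ioi 0) := by
    intro s hs
    have hs : 0 < s := hs
    simp only [KR_of_pos ξ (show 0 < t + s by positivity), Matrix.mulVec_smul, Matrix.smul_mulVec,
      Matrix.smul_mul, smul_comm (alphaFun γ ξ), smul_smul, ← Real.exp_add]
    ring_nf
  have j₁ := IntegrableOn.congr_fun (i₁.smul (Real.exp (-(jap ξ * t)))) c₁ measurableSet_Ioo
  have j₂ := IntegrableOn.congr_fun (i₂.smul (Real.exp (jap ξ * t))) c₂ measurableSet_Ioi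
  have j₃ := IntegrableOn.congr_fun (i₃.smul (Real.exp (-(jap ξ * t)))) c₃ measurableSet_Ioi
  have j₁' := (integrableOn_Ioc_iff_integrableOn_Ioo (μ := volume)).mpr j₁
  have hu : Set.Ioc 0 t ∪ Set.Ioi t = Set.Ioi 0 := Set.Ioc_union_Ioi_eq_Ioi ht
  have hd : Disjoint (Set.Ioc 0 t) (Set.Ioi t) := Set.Ioc_disjoint_Ioi le_rfl
  have hv : (∫ s in Set.Ioi (0 : ℝ), Real.exp (-jap ξ * s) • Ψ s) - expPrimitive (-jap ξ) Ψ t =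
      ∫ s in Set.Ioi t, Real.exp (-jap ξ * s) • Ψ s := by
    rw [← hu, setIntegral_union hd measurableSet_Ioi hm.integrableOn hm.integrableOn,
      expPrimitive, intervalIntegral.integral_of_le ht, add_sub_cancel_left]
  have hw : expPrimitive (jap ξ) Ψ t = ∫ s in Set.Ioo 0 t, Real.exp (jap ξ * s) • Ψ s := by
    rw [expPrimitive, intervalIntegral.integral_of_le ht, integral_Ioc_eq_integral_Ioo]
  simp only [Khalf, Matrix.add_mulVec]
  rw [hv, hw, ← e₁, ← e₂, ← e₃, ← integral_smul, ← integral_smul, ← integral_smul,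
    setIntegral_congr_fun measurableSet_Ioo c₁, setIntegral_congr_fun measurableSet_Ioi c₂,
    setIntegral_congr_fun measurableSet_Ioi c₃, ← integral_Ioc_eq_integral_Ioo,
    ← setIntegral_union hd measurableSet_Ioi j₁' j₂, hu]
  exact integral_add (hu ▸ j₁'.union j₂) j₃

theorem alphaFun_mul_denominator (γ ξ : ℝ) :
    alphaFun γ ξ * (1 + Complex.I * (γ : ℂ) * ((jap ξ + ξ : ℝ) : ℂ)) =
      (γ : ℂ) + Complex.I * ((jap ξ + ξ : ℝ) : ℂ) := by
  refine div_mul_cancel₀ _ fun h => ?_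
  simpa using congrArg Complex.re h

theorem stmt4 (γ : ℝ) (hγ : 0 < γ) (ξ : ℝ) (Ψ : ℝ → Fin 2 → ℂ)
    (hΨ : ContDiff ℝ (⊤ : ℕ∞) Ψ) (hcs : HasCompactSupport Ψ)
    (hsupp : tsupport Ψ ⊆ Set.Ioi (0 : ℝ))
    (Φ : ℝ → Fin 2 → ℂ)
    (hΦ : ∀ t : ℝ, Φ t = ∫ t' in Set.Ioi (0 : ℝ), (Khalf γ ξ t t').mulVec (Ψ t')) :
    ContDiffOn ℝ (⊤ : ℕ∞) Φ (Set.Ici (0 : ℝ)) ∧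
      (∀ t : ℝ, 0 < t →
        (ξ : ℂ) * Φ t 1 - deriv (fun s => Φ s 1) t - Complex.I * Φ t 0 = Ψ t 0 ∧
        (ξ : ℂ) * Φ t 0 + deriv (fun s => Φ s 0) t - Complex.I * Φ t 1 = Ψ t 1) ∧
      Φ 0 1 = (γ : ℂ) * Φ 0 0 := by
  have hK : (2 * (jap ξ : ℂ))⁻¹ * (2 * jap ξ) = 1 :=
    inv_mul_cancel₀ (by exact_mod_cast (mul_pos two_pos (jap_pos ξ)).ne')
  have hJ2 : (jap ξ : ℂ) ^ 2 = (ξ : ℂ) ^ 2 + 1 := by exact_mod_cast jap_sq ξ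
  have hrep := fun {t : ℝ} (ht : 0 ≤ t) =>
    (hΦ t).trans (integral_Khalf_mulVec γ ξ hΨ.continuous hcs ht)
  generalize (∫ s in Set.Ioi (0 : ℝ), Real.exp (-jap ξ * s) • Ψ s) = V at hrep
  have hα := alphaFun_mul_denominator γ ξ
  generalize alphaFun γ ξ = α at hrep hα
  refine ⟨?_, fun t ht => ?_, ?_⟩
  · refine ContDiffOn.congr (ContDiff.contDiffOn ?_) fun t ht => hrep ht
    have hU := contDiff_pi.mp (contDiff_expPrimitive (jap ξ) hΨ)
    have hW := contDiff_pi.mp (contDiff_expPrimitive (-jap ξ) hΨ)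
    refine contDiff_pi.mpr fun i => ?_
    have h0 := hU 0
    have h1 := hU 1
    have k0 := hW 0
    have k1 := hW 1
    simp only [Pi.add_apply, Pi.smul_apply, Matrix.mulVec, dotProduct, Fin.sum_univ_two,
      Pi.sub_apply]
    fun_prop
  · have hU := fun i => hasDerivAt_pi.mp (hasDerivAt_expPrimitive (jap ξ) hΨ.continuous t) i
    have hW := fun i => hasDerivAt_pi.mp (hasDerivAt_expPrimitive (-jap ξ) hΨ.continuous t) i
    have hE : HasDerivAt (fun s : ℝ => Real.exp (-(jap ξ * s)))
        (Real.exp (-(jap ξ * t)) * -(jap ξ * 1)) t :=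
      (((hasDerivAt_id t).const_mul (jap ξ)).neg).exp
    have hF : HasDerivAt (fun s : ℝ => Real.exp (jap ξ * s))
        (Real.exp (jap ξ * t) * (jap ξ * 1)) t :=
      ((hasDerivAt_id t).const_mul (jap ξ)).exp
    have hev : ∀ i, (fun s => Φ s i) =ᶠ[nhds t] _ := fun i =>
      (eventually_ge_nhds ht).mono fun s hs => congrFun (hrep hs) i
    have hder := fun i => (((hE.smul (((hU 0).const_mul (signMatrix ξ 1 i 0)).add
      ((hU 1).const_mul (signMatrix ξ 1 i 1)))).add
      (hF.smul ((((hW 0).const_sub (V 0)).const_mul (signMatrix ξ (-1) i 0)).add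
      (((hW 1).const_sub (V 1)).const_mul (signMatrix ξ (-1) i 1))))).add
      (hE.smul_const ((α • (signMatrix ξ 1 * pauli1)).mulVec V i))).congr_of_eventuallyEq
      ((hev i).trans (.of_eq (by
        ext s
        simp only [Pi.add_apply, Pi.smul_apply, Pi.sub_apply, Matrix.mulVec, dotProduct,
          Fin.sum_univ_two, Pi.smul_apply'])))
    rw [(hder 0).deriv, (hder 1).deriv, hrep ht.le]
    have hexp : (Real.exp (-(jap ξ * t)) : ℂ) * Real.exp (jap ξ * t) = 1 := by
      rw [← Complex.ofReal_mul, ← Real.exp_add]; simp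
    simp only [Pi.add_apply, Pi.smul_apply, Pi.sub_apply, Matrix.mulVec, dotProduct,
      Fin.sum_univ_two, signMatrix, pauli1, Matrix.smul_apply, Matrix.mul_apply,
      Complex.real_smul, smul_eq_mul, Matrix.of_apply, Matrix.cons_val', Matrix.cons_val_zero,
      Matrix.cons_val_one, Matrix.cons_val_fin_one, neg_mul]
    generalize Real.exp (-(jap ξ * t)) = E at hexp ⊢
    generalize Real.exp (jap ξ * t) = F at hexp ⊢
    generalize expPrimitive (jap ξ) Ψ t = U
    generalize expPrimitive (-jap ξ) Ψ t = W
    push_cast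
    constructor
    · linear_combination (2 * (jap ξ : ℂ))⁻¹ * (E * U 0 + F * (V 0 - W 0) + α * E * V 1) *
        (-hJ2 - Complex.I_sq) + 2 * jap ξ * (2 * (jap ξ : ℂ))⁻¹ * Ψ t 0 * hexp + Ψ t 0 * hK
    · linear_combination (2 * (jap ξ : ℂ))⁻¹ * (E * U 1 + F * (V 1 - W 1) + α * E * V 0) *
        (-hJ2 - Complex.I_sq) + 2 * jap ξ * (2 * (jap ξ : ℂ))⁻¹ * Ψ t 1 * hexp + Ψ t 1 * hK
  · have hz : ∀ a, expPrimitive a Ψ 0 = 0 := fun a => intervalIntegral.integral_same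
    rw [hrep le_rfl]
    simp only [hz, Pi.add_apply, Pi.smul_apply, Pi.sub_apply, Matrix.mulVec, dotProduct,
      Fin.sum_univ_two, signMatrix, pauli1, Matrix.smul_apply, Matrix.mul_apply,
      Complex.real_smul, smul_eq_mul, Matrix.of_apply, Matrix.cons_val', Matrix.cons_val_zero,
      Matrix.cons_val_one, Matrix.cons_val_fin_one, mul_zero, neg_zero, Real.exp_zero,
      Pi.zero_apply]
    push_cast at hα ⊢
    linear_combination (2 * (jap ξ : ℂ))⁻¹ * (V 0 * (Complex.I * hα +
      (ξ + jap ξ) * (1 - γ * α) * Complex.I_sq) +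
      V 1 * ((ξ - jap ξ) * hα - Complex.I * (1 - α * γ) * hJ2))
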